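/- Let q be a prime power with q ≡ 1 (mod 4), let r be an odd prime dividing q + 1, and set t = r·(q − 1)₂, where (q − 1)₂ is the 2-part of q − 1. Let θ ∈ F_{q²} have multiplicative order t, and let a, b be integers of opposite parity with a coprime to r. Then there exists a matrix g ∈ SL(4, F_q) whose characteristic polynomial, regarded over F_{q²}, equals (X − θ^a)(X − θ^{aq})(X − θ^{rb})(X − θ^{−a(1+q)−rb}); moreover g has order t and ⟨g⟩ ∩ Z(SL(4, F_q)) = 1. -/

import Mathlib

open Matrix Polynomial

/-- The 2-part of a natural number: the highest power of `2` dividing it. -/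
def twoPart (n : ℕ) : ℕ := 2 ^ padicValNat 2 n


lemma descend_aux {F E : Type} [Field F] [Fintype F] [Field E] (f : F →+* E) (x : E)
    (hx : x ^ Fintype.card F = x) : ∃ y, f y = x := by
  classical
  have h1 : 1 < Fintype.card F := Fintype.one_lt_card
  have hne : (X ^ Fintype.card F - X : E[X]) ≠ 0 := FiniteField.X_pow_card_sub_X_ne_zero E h1
  have hsub : Finset.univ.image f ⊆ (X ^ Fintype.card F - X : E[X]).roots.toFinset := by
    intro z hz
    obtain ⟨y, -, rfl⟩ := Finset.mem_image.1 hz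
    rw [Multiset.mem_toFinset, mem_roots hne]
    simp [← map_pow, FiniteField.pow_card]
  have hcard : (X ^ Fintype.card F - X : E[X]).roots.toFinset.card ≤ (Finset.univ.image f).card := by
    rw [Finset.card_image_of_injective _ f.injective, Finset.card_univ]
    refine (Multiset.toFinset_card_le _).trans ((card_roots' _).trans ?_)
    rw [FiniteField.X_pow_card_sub_X_natDegree_eq E h1]
  have heq := Finset.eq_of_subset_of_card_le hsub hcard
  have : x ∈ Finset.univ.image f := by
    rw [heq, Multiset.mem_toFinset, mem_roots hne]
    simp [hx]
  obtain ⟨y, -, h⟩ := Finset.mem_image.1 this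
  exact ⟨y, h⟩

lemma matrix_aux {F E : Type} [Field F] [Field E] (f : F →+* E) (l l' m n : E) (hl : l ≠ l')
    (s d u v : F) (hs : f s = l + l') (hd : f d = l * l') (hu : f u = m) (hv : f v = n)
    (h1 : l * l' * m * n = 1) :
    ∃ g : SpecialLinearGroup (Fin 4) F,
      Matrix.charpoly ((g : Matrix (Fin 4) (Fin 4) F).map f) =
        (X - C l) * (X - C l') * (X - C m) * (X - C n) ∧
      (∀ k : ℕ, l ^ k = 1 → l' ^ k = 1 → m ^ k = 1 → n ^ k = 1 → g ^ k = 1) ∧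
      (∀ (k : ℕ), g ^ k ∈ Subgroup.center (SpecialLinearGroup (Fin 4) F) → l ^ k = m ^ k) := by
  let M : Matrix (Fin 4) (Fin 4) F := !![0, -d, 0, 0; 1, s, 0, 0; 0, 0, u, 0; 0, 0, 0, v]
  have hM : M.det = 1 := by
    apply f.injective
    have : M.det = d * u * v := by
      simp [M, Matrix.det_succ_row_zero, Fin.sum_univ_succ, Fin.succAbove, submatrix, mul_assoc]
    rw [this, map_mul, map_mul, hd, hu, hv, h1, map_one]
  let P : Matrix (Fin 4) (Fin 4) E := !![1, l, 0, 0; 1, l', 0, 0; 0, 0, 1, 0; 0, 0, 0, 1]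
  have hP : IsUnit P.det := by
    have : P.det = l' - l := by
      simp [P, Matrix.det_succ_row_zero, Fin.sum_univ_succ, Fin.succAbove, submatrix]
      try ring
    rw [this, isUnit_iff_ne_zero, sub_ne_zero]
    exact hl.symm
  have hPu : IsUnit P := (Matrix.isUnit_iff_isUnit_det _).2 hP
  let w : Fin 4 → E := ![l, l', m, n]
  have hPM : P * M.map f = diagonal w * P := by
    ext i j
    fin_cases i <;> fin_cases j <;>
      simp [P, M, w, Matrix.mul_apply, Fin.sum_univ_succ, hs, hd, hu, hv, diagonal] <;> ring
  have hpow : ∀ k : ℕ, P * (M ^ k).map f = diagonal (w ^ k) * P := by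
    intro k
    rw [← diagonal_pow]
    have : (M ^ k).map f = (M.map f) ^ k := map_pow f.mapMatrix M k
    rw [this]
    exact (show SemiconjBy P (M.map f) (diagonal w) from hPM).pow_right k
  refine ⟨⟨M, hM⟩, ?_, ?_, ?_⟩
  · obtain ⟨U, hU⟩ := hPu
    have : M.map f = (U⁻¹).val * diagonal w * U.val := by
      rw [mul_assoc, hU, ← hPM, ← hU, Units.inv_mul_cancel_left]
    change (M.map f).charpoly = _
    rw [this, Matrix.coe_units_inv, Matrix.charpoly_units_conj', charpoly_diagonal]
    simp [w, Fin.prod_univ_succ, mul_assoc]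
  · intro k e1 e2 e3 e4
    apply Subtype.ext
    have h := hpow k
    have hw : w ^ k = 1 := by
      ext i
      fin_cases i <;> simp [w, e1, e2, e3, e4]
    rw [hw, diagonal_one', one_mul] at h
    have h2 : (M ^ k).map f = 1 := hPu.mul_left_cancel (by rw [h, mul_one])
    have h3 : f.mapMatrix (M ^ k) = f.mapMatrix 1 := by rw [map_one]; exact h2
    have h4 : M ^ k = 1 := Matrix.map_injective f.injective h3
    simpa using! h4
  · intro k hk
    obtain ⟨c, -, hc⟩ := Matrix.SpecialLinearGroup.mem_center_iff.1 hk
    have hc' : scalar (Fin 4) c = M ^ k := by simpa using! hc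
    have h := hpow k
    rw [← hc'] at h
    have e1 := congrFun (congrFun h 0) 0
    have e2 := congrFun (congrFun h 2) 2
    simp [P, w, Matrix.mul_apply, Fin.sum_univ_succ, diagonal] at e1 e2
    rw [← e1, ← e2]

/-- For `q ≡ 1 (mod 4)` a prime power, `r` an odd prime dividing `q + 1`, and
`t = r·(q - 1)₂`, given `θ ∈ F_{q²}` of order `t` and integers `a, b` of opposite parity
with `a` coprime to `r`, there is `g ∈ SL(4, F_q)` of order `t`, intersecting the center
trivially, with characteristic polynomial
`(X - θ^a)(X - θ^{aq})(X - θ^{rb})(X - θ^{-a(1+q)-rb})` over `F_{q²}`. -/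
theorem sl4_element_order_r_twoPart
    (q : ℕ) (hq : q % 4 = 1)
    (F : Type) [Field F] [Fintype F] (hF : Fintype.card F = q)
    (E : Type) [Field E] [Fintype E] (hE : Fintype.card E = q ^ 2)
    (f : F →+* E)
    (r : ℕ) (hr : r.Prime) (hrodd : Odd r) (hrdvd : r ∣ q + 1)
    (θ : Eˣ) (hθ : orderOf θ = r * twoPart (q - 1))
    (a b : ℤ) (hab : (Even a ∧ Odd b) ∨ (Odd a ∧ Even b)) (har : IsCoprime a (r : ℤ)) :
    ∃ g : SpecialLinearGroup (Fin 4) F,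
      Matrix.charpoly ((g : Matrix (Fin 4) (Fin 4) F).map f) =
        (X - C ((θ ^ a : Eˣ) : E)) * (X - C ((θ ^ (a * (q : ℤ)) : Eˣ) : E)) *
          (X - C ((θ ^ ((r : ℤ) * b) : Eˣ) : E)) *
          (X - C ((θ ^ (-(a * (1 + (q : ℤ))) - (r : ℤ) * b) : Eˣ) : E)) ∧
      orderOf g = r * twoPart (q - 1) ∧
      Subgroup.zpowers g ⊓ Subgroup.center (SpecialLinearGroup (Fin 4) F) = ⊥ := by
  obtain ⟨s, hs⟩ : ∃ s, s = twoPart (q - 1) := ⟨_, rfl⟩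
  have hsdvd : s ∣ q - 1 := hs ▸ pow_padicValNat_dvd
  have hq1 : 1 < q := hF ▸ Fintype.one_lt_card
  have hsz : (s : ℤ) ∣ (q : ℤ) - 1 := by
    have := Int.natCast_dvd_natCast.2 hsdvd
    rwa [Nat.cast_sub hq1.le, Nat.cast_one] at this
  have hrz : (r : ℤ) ∣ 1 + (q : ℤ) := by
    have := Int.natCast_dvd_natCast.2 hrdvd
    push_cast at this
    rwa [add_comm] at this
  have hθ' : orderOf θ = r * s := by rw [hθ, hs]
  have hone : ∀ i : ℤ, θ ^ i = 1 ↔ (r * s : ℤ) ∣ i := by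
    intro i
    rw [← orderOf_dvd_iff_zpow_eq_one, hθ']
    push_cast
    rfl
  have hr2 : ¬ r ∣ 2 := by
    intro h
    have := (Nat.prime_dvd_prime_iff_eq hr Nat.prime_two).1 h
    subst this
    exact absurd hrodd (by decide)
  have hrp : Prime (r : ℤ) := Nat.prime_iff_prime_int.1 hr
  have hra : ¬ (r : ℤ) ∣ a := by
    intro h
    exact hrp.not_isUnit (har.isUnit_of_dvd' h dvd_rfl)
  have hcop : IsCoprime (r * s : ℤ) (a - r * b) := by
    refine IsCoprime.mul_left ?_ ?_
    · have : a - r * b = a + r * (-b) := by ring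
      rw [this]
      exact har.symm.add_mul_left_right _
    · rw [hs, twoPart]
      push_cast
      apply IsCoprime.pow_left
      have hodd : Odd (a - r * b) := by
        have hr' : Odd (r : ℤ) := by exact_mod_cast hrodd
        rcases hab with ⟨h1, h2⟩ | ⟨h1, h2⟩
        · exact h1.sub_odd (hr'.mul h2)
        · exact h1.sub_even (h2.mul_left _)
      obtain ⟨c, hc⟩ := hodd
      exact ⟨-c, 1, by rw [hc]; ring⟩
  -- fixed elements
  have hfix : ∀ i : ℤ, (r : ℤ) ∣ i → ∃ y, f y = ((θ ^ i : Eˣ) : E) := by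
    intro i hi
    apply descend_aux
    rw [hF, ← Units.val_pow_eq_pow_val]
    congr 1
    rw [← zpow_natCast, ← _root_.zpow_mul, ← mul_inv_eq_one, ← _root_.zpow_neg, ← _root_.zpow_add, hone]
    have : i * q + -i = i * (q - 1) := by ring
    rw [this]
    exact mul_dvd_mul hi hsz
  have hq2 : ∀ x : E, (x ^ q) ^ q = x := by
    intro x
    rw [← pow_mul, ← sq, ← hE, FiniteField.pow_card]
  have hl' : ((θ ^ (a * (q : ℤ)) : Eˣ) : E) = ((θ ^ a : Eˣ) : E) ^ q := by
    rw [_root_.zpow_mul, zpow_natCast, Units.val_pow_eq_pow_val]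
  obtain ⟨σ, hσ⟩ : ∃ y, f y = ((θ ^ a : Eˣ) : E) + ((θ ^ (a * (q : ℤ)) : Eˣ) : E) := by
    apply descend_aux
    letI := f.toAlgebra
    have := map_add (FiniteField.frobeniusAlgHom F E) ((θ ^ a : Eˣ) : E)
      ((θ ^ (a * (q : ℤ)) : Eˣ) : E)
    simp only [FiniteField.coe_frobeniusAlgHom] at this
    rw [this, hF, hl', hq2, add_comm]
  obtain ⟨d, hd⟩ : ∃ y, f y = ((θ ^ a : Eˣ) : E) * ((θ ^ (a * (q : ℤ)) : Eˣ) : E) := by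
    rw [← Units.val_mul, ← _root_.zpow_add]
    apply hfix
    have : a + a * q = a * (1 + q) := by ring
    rw [this]
    exact hrz.mul_left _
  obtain ⟨u, hu⟩ := hfix (r * b) (dvd_mul_right _ _)
  obtain ⟨v, hv⟩ := hfix (-(a * (1 + (q : ℤ))) - (r : ℤ) * b)
    (dvd_sub ((hrz.mul_left _).neg_right) (dvd_mul_right _ _))
  have hne : ((θ ^ a : Eˣ) : E) ≠ ((θ ^ (a * (q : ℤ)) : Eˣ) : E) := by
    intro h
    have h := Units.ext h
    rw [eq_comm, ← mul_inv_eq_one, ← _root_.zpow_neg, ← _root_.zpow_add, hone] at h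
    have h2 : (r : ℤ) ∣ a * (q - 1) := by
      have := (dvd_mul_right (r : ℤ) s).trans h
      rwa [show a * (q : ℤ) + -a = a * (q - 1) by ring] at this
    rcases hrp.dvd_or_dvd h2 with h3 | h3
    · exact hra h3
    · apply hr2
      have := dvd_sub hrz h3
      rw [show (1 + (q : ℤ)) - (q - 1) = (2 : ℕ) by push_cast; ring] at this
      exact Int.natCast_dvd_natCast.1 this
  have hdet : ((θ ^ a : Eˣ) : E) * ((θ ^ (a * (q : ℤ)) : Eˣ) : E) *
      ((θ ^ ((r : ℤ) * b) : Eˣ) : E) *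
      ((θ ^ (-(a * (1 + (q : ℤ))) - (r : ℤ) * b) : Eˣ) : E) = 1 := by
    rw [← Units.val_mul, ← Units.val_mul, ← Units.val_mul, ← _root_.zpow_add, ← _root_.zpow_add, ← _root_.zpow_add]
    rw [show a + a * (q : ℤ) + r * b + (-(a * (1 + (q : ℤ))) - (r : ℤ) * b) = 0 by ring]
    simp
  obtain ⟨g, hg1, hg2, hg3⟩ := matrix_aux f _ _ _ _ hne σ d u v hσ hd hu hv hdet
  have hpt : ∀ i : ℤ, ((θ ^ i : Eˣ) : E) ^ (r * s) = 1 := by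
    intro i
    rw [← Units.val_pow_eq_pow_val, ← zpow_natCast, ← _root_.zpow_mul, Units.val_eq_one, hone]
    push_cast
    exact dvd_mul_left _ _
  have hgt : g ^ (r * s) = 1 := hg2 _ (hpt _) (hpt _) (hpt _) (hpt _)
  have key : ∀ k : ℕ, g ^ k ∈ Subgroup.center (SpecialLinearGroup (Fin 4) F) → r * s ∣ k := by
    intro k hk
    have h := hg3 k hk
    rw [← Units.val_pow_eq_pow_val, ← Units.val_pow_eq_pow_val] at h
    have h := Units.ext h
    rw [← zpow_natCast, ← zpow_natCast, ← _root_.zpow_mul, ← _root_.zpow_mul, ← mul_inv_eq_one, ← _root_.zpow_neg,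
      ← _root_.zpow_add, hone, show a * (k : ℤ) + -(r * b * k) = (a - r * b) * k by ring] at h
    have h := hcop.dvd_of_dvd_mul_left h
    exact_mod_cast h
  refine ⟨g, hg1, ?_, ?_⟩
  · rw [← hs]
    refine Nat.dvd_antisymm (orderOf_dvd_of_pow_eq_one hgt) (key _ ?_)
    rw [pow_orderOf_eq_one]
    exact one_mem _
  · rw [eq_bot_iff]
    rintro x ⟨hx1, hx2⟩
    have : Finite (SpecialLinearGroup (Fin 4) F) := Subtype.finite
    obtain ⟨k, rfl⟩ := mem_powers_iff_mem_zpowers.2 hx1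
    obtain ⟨c, hc⟩ := key k hx2
    change g ^ k ∈ _
    rw [hc, pow_mul, hgt, one_pow]
    exact one_mem _
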